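/- Let (t₁,ξ₁),(t₂,ξ₂),(t₃,ξ₃),(t₄,ξ₄) be four distinct points in ℝ² forming a (1,3) configuration: there exist two distinct parallel lines in ℝ² such that one of them contains exactly one of the four points and the other contains exactly three of them. If f : ℝ → ℂ is a Schwartz function and d₁,d₂,d₃,d₄ ∈ ℂ are not all zero and satisfy d₁f(x+t₁)e^{2πiξ₁x} + d₂f(x+t₂)e^{2πiξ₂x} + d₃f(x+t₃)e^{2πiξ₃x} + d₄f(x+t₄)e^{2πiξ₄x} = 0 for almost every x ∈ ℝ, then f is identically zero. -/

import Mathlib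

open MeasureTheory Filter

/-- `e x = e^{2πix}`. -/
noncomputable def e (x : ℝ) : ℂ := Complex.exp (2 * Real.pi * Complex.I * x)

lemma e_add (x y : ℝ) : e (x + y) = e x * e y := by
  simp only [e, ← Complex.exp_add]
  congr 1
  push_cast
  ring

lemma e_intCast (m : ℤ) : e m = 1 := by
  have h := Complex.exp_int_mul_two_pi_mul_I m
  rw [← h, e]
  congr 1
  push_cast
  ring

lemma norm_e (x : ℝ) : ‖e x‖ = 1 := by
  rw [e, show (2 * Real.pi * Complex.I * x : ℂ) = ((2 * Real.pi * x : ℝ) : ℂ) * Complex.I by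
    push_cast; ring]
  exact Complex.norm_exp_ofReal_mul_I _

lemma continuous_e : Continuous e := by
  unfold e
  fun_prop

lemma norm_e_sub_one (x : ℝ) : ‖e x - 1‖ = 2 * |Real.sin (Real.pi * x)| := by
  have h := Complex.norm_exp_I_mul_ofReal_sub_one (2 * Real.pi * x)
  rw [e, show (2 * Real.pi * Complex.I * x : ℂ) = Complex.I * ((2 * Real.pi * x : ℝ) : ℂ) by
    push_cast; ring, h, Real.norm_eq_abs, abs_mul, abs_two]
  congr 3
  ring

lemma norm_e_sub_one_le (x : ℝ) : ‖e x - 1‖ ≤ 2 * Real.pi * |x| := by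
  rw [norm_e_sub_one]
  have h := Real.abs_sin_le_abs (x := Real.pi * x)
  rw [abs_mul, abs_of_pos Real.pi_pos] at h
  linarith

lemma le_norm_e_sub_one {x : ℝ} (h0 : 0 ≤ x) (h1 : x ≤ 1) : 4 * min x (1 - x) ≤ ‖e x - 1‖ := by
  have key : ∀ y : ℝ, 0 ≤ y → y ≤ 1 / 2 → 2 * y ≤ Real.sin (Real.pi * y) := by
    intro y hy0 hy1
    have h := Real.mul_le_sin (x := Real.pi * y) (by positivity)
      (by nlinarith [Real.pi_pos])
    calc 2 * y = 2 / Real.pi * (Real.pi * y) := by field_simp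
      _ ≤ _ := h
  rw [norm_e_sub_one]
  rcases le_total x (1 / 2) with h | h
  · have := key x h0 h
    rw [min_eq_left (by linarith)]
    linarith [le_abs_self (Real.sin (Real.pi * x))]
  · have := key (1 - x) (by linarith) (by linarith)
    rw [show Real.pi * (1 - x) = Real.pi - Real.pi * x by ring, Real.sin_pi_sub] at this
    rw [min_eq_right (by linarith)]
    linarith [le_abs_self (Real.sin (Real.pi * x))]

lemma norm_e_sub_e (x y : ℝ) : ‖e x - e y‖ = ‖e (x - y) - 1‖ := by
  have h : e x - e y = e y * (e (x - y) - 1) := by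
    rw [mul_sub, ← e_add, mul_one]
    congr 2
    ring
  rw [h, norm_mul, norm_e, one_mul]

lemma exists_e_eq {z : ℂ} (hz : ‖z‖ = 1) : ∃ τ, e τ = z := by
  refine ⟨z.arg / (2 * Real.pi), ?_⟩
  have h := Complex.norm_mul_exp_arg_mul_I z
  rw [hz] at h
  have hπ : (Real.pi : ℂ) ≠ 0 := by exact_mod_cast Real.pi_ne_zero
  have harg : (2 * Real.pi * Complex.I * (z.arg / (2 * Real.pi) : ℝ) : ℂ) = z.arg * Complex.I := by
    push_cast
    field_simp
  rw [e, harg]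
  simpa using h

/-- The points `γ m`, `0 ≤ m < q`, are as separated modulo one as the points `r / q`, up to a
bounded error. -/
lemma residue_le_norm_e_sub_e {γ τ : ℝ} {a : ℤ} {q : ℕ} (hq : 0 < q)
    (hγ : |γ - a / q| ≤ 1 / (q : ℝ) ^ 2) {m : ℕ} (hm : m < q) :
    4 * min ((((m * a - ⌊q * τ⌋) % q : ℤ) : ℝ)) (q - (((m * a - ⌊q * τ⌋) % q : ℤ) : ℝ)) - 13
      ≤ q * ‖e (γ * m) - e τ‖ := by
  have hq' : (0 : ℝ) < q := by exact_mod_cast hq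
  have hqz : (q : ℤ) ≠ 0 := by exact_mod_cast hq.ne'
  set z := ⌊q * τ⌋ with hz
  set r : ℤ := (m * a - z) % q with hr
  set k : ℤ := (m * a - z) / q with hk
  have hrk : (m * a - z : ℝ) = r + q * k := by
    have := Int.emod_add_mul_ediv (m * a - z) q
    rw [← hr, ← hk] at this
    exact_mod_cast this.symm
  have hr0 : (0 : ℝ) ≤ r := by exact_mod_cast Int.emod_nonneg _ hqz
  have hr1 : (r : ℝ) ≤ q := by
    exact_mod_cast (Int.emod_lt_of_pos (m * a - z) (by exact_mod_cast hq : (0 : ℤ) < q)).le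
  have hmq : (m : ℝ) ≤ q := by exact_mod_cast hm.le
  set w : ℝ := γ * m - τ - r / q - k with hw
  have hwq : q * w = q * m * (γ - a / q) + (z - q * τ) := by
    rw [hw]
    field_simp
    linarith
  have hw2 : |q * w| ≤ 2 := by
    rw [hwq]
    have h1 : |q * m * (γ - a / q)| ≤ 1 := by
      rw [abs_mul, abs_of_nonneg (by positivity)]
      calc (q * m : ℝ) * |γ - a / q| ≤ q * q * (1 / (q : ℝ) ^ 2) := by gcongr
        _ = 1 := by field_simp
    have h2 : |(z : ℝ) - q * τ| ≤ 1 := by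
      rw [abs_le]
      constructor <;> linarith [Int.floor_le (q * τ), Int.lt_floor_add_one (q * τ)]
    exact (abs_add_le _ _).trans (by linarith)
  have hsplit : e (γ * m - τ) = e (r / q) * e w := by
    have : γ * m - τ = r / q + w + k := by rw [hw]; ring
    rw [this, e_add, e_add, e_intCast, mul_one]
  have h1 : ‖e (r / q) - 1‖ ≤ ‖e (γ * m - τ) - 1‖ + ‖e w - 1‖ := by
    have : e (r / q) - 1 = (e (γ * m - τ) - 1) - e (r / q) * (e w - 1) := by rw [hsplit]; ring
    rw [this]
    refine (norm_sub_le _ _).trans ?_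
    rw [norm_mul, norm_e, one_mul]
  have h2 := norm_e_sub_one_le w
  have h3 : 4 * min (r / q : ℝ) (1 - r / q) ≤ ‖e (r / q) - 1‖ :=
    le_norm_e_sub_one (by positivity) (by rw [div_le_one hq']; exact hr1)
  have h4 : q * min (r / q : ℝ) (1 - r / q) = min (r : ℝ) (q - r) := by
    rw [mul_min_of_nonneg _ _ hq'.le]
    congr 1 <;> field_simp
  rw [norm_e_sub_e, ← h4]
  have h5 : q * (2 * Real.pi * |w|) ≤ 13 := by
    rw [abs_mul, abs_of_pos hq'] at hw2
    nlinarith [Real.pi_lt_d2, Real.pi_pos]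
  nlinarith

lemma sum_range_le_of_rational_approx {γ τ : ℝ} {a : ℤ} {q : ℕ} (hq : 0 < q)
    (ha : IsCoprime a q) (hγ : |γ - a / q| ≤ 1 / (q : ℝ) ^ 2) {F : ℕ → ℝ} {Λ C : ℝ}
    (hΛ : 0 ≤ Λ) (hC : 0 ≤ C) (hFΛ : ∀ m, F m ≤ Λ)
    (hFC : ∀ m : ℕ, 0 < ‖e (γ * m) - e τ‖ → F m ≤ C / (q * ‖e (γ * m) - e τ‖)) :
    ∑ m ∈ Finset.range q, F m ≤ 14 * Λ + 2 * C * (1 + Real.log q) := by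
  have hq' : (0 : ℝ) < q := by exact_mod_cast hq
  have hqz : (0 : ℤ) < q := by exact_mod_cast hq
  let h : ℕ → ℝ := fun r ↦ (if r < 7 then Λ else 0) + C * (r : ℝ)⁻¹
  have h0 : ∀ r, 0 ≤ h r := fun r ↦ by
    have : 0 ≤ (if r < 7 then Λ else 0) := by split_ifs <;> simp [hΛ]
    positivity
  let ρ : ℕ → ℕ := fun m ↦ ((m * a - ⌊q * τ⌋) % q : ℤ).toNat
  have hρz : ∀ m, ((ρ m : ℕ) : ℤ) = (m * a - ⌊q * τ⌋) % q := fun m ↦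
    Int.toNat_of_nonneg (Int.emod_nonneg _ hqz.ne')
  have hρlt : ∀ m, ρ m < q := fun m ↦ by
    have := Int.emod_lt_of_pos (m * a - ⌊q * τ⌋) hqz
    rw [← hρz] at this
    exact_mod_cast this
  have hinj : Set.InjOn ρ (Finset.range q) := by
    intro m hm m' hm' hmm
    simp only [Finset.coe_range, Set.mem_Iio] at hm hm'
    have h1 : ((m * a - ⌊q * τ⌋) % q : ℤ) = (m' * a - ⌊q * τ⌋) % q := by
      rw [← hρz, ← hρz, hmm]
    have h2 := Int.ModEq.dvd (show (m * a - ⌊q * τ⌋ : ℤ) ≡ m' * a - ⌊q * τ⌋ [ZMOD q] from h1)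
    have h3 : (q : ℤ) ∣ (m' - m) * a := by
      convert h2 using 1
      ring
    have h4 : (q : ℤ) ∣ m' - m := ha.symm.dvd_of_dvd_mul_right h3
    have h5 := Int.eq_zero_of_abs_lt_dvd h4 (by rw [abs_lt]; constructor <;> omega)
    omega
  have hterm : ∀ m ∈ Finset.range q, F m ≤ h (ρ m) + h (q - ρ m) := by
    intro m hm
    have hlt := hρlt m
    have hres := residue_le_norm_e_sub_e (τ := τ) hq hγ (Finset.mem_range.1 hm)
    rw [← hρz] at hres
    by_cases h7 : ρ m < 7
    · have : F m ≤ h (ρ m) := by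
        have : 0 ≤ C * (ρ m : ℝ)⁻¹ := by positivity
        simp only [h, if_pos h7]
        linarith [hFΛ m]
      linarith [h0 (q - ρ m)]
    by_cases h7' : q - ρ m < 7
    · have : F m ≤ h (q - ρ m) := by
        have : 0 ≤ C * ((q - ρ m : ℕ) : ℝ)⁻¹ := by positivity
        simp only [h, if_pos h7']
        linarith [hFΛ m]
      linarith [h0 (ρ m)]
    have hcast : ((q - ρ m : ℕ) : ℝ) = q - ρ m := by push_cast [hlt.le]; ring
    have hA : (7 : ℝ) ≤ ρ m := by exact_mod_cast not_lt.1 h7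
    have hB : (7 : ℝ) ≤ q - ρ m := by rw [← hcast]; exact_mod_cast not_lt.1 h7'
    have hbig : ∀ s : ℝ, 7 ≤ s → 4 * s - 13 ≤ q * ‖e (γ * m) - e τ‖ → F m ≤ C * s⁻¹ := by
      intro s hs hle
      have hpos : 0 < ‖e (γ * m) - e τ‖ := by
        by_contra hcon
        have : ‖e (γ * m) - e τ‖ = 0 := le_antisymm (not_lt.1 hcon) (norm_nonneg _)
        rw [this] at hle
        linarith
      refine (hFC m hpos).trans ?_
      rw [div_eq_mul_inv]
      gcongr
      linarith
    simp only [Int.cast_natCast] at hres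
    rcases le_total (ρ m : ℝ) (q - ρ m) with hle | hle
    · rw [min_eq_left hle] at hres
      have := hbig _ hA hres
      have h2 : C * (ρ m : ℝ)⁻¹ ≤ h (ρ m) := by simp [h, if_neg h7]
      linarith [h0 (q - ρ m)]
    · rw [min_eq_right hle] at hres
      have := hbig _ hB hres
      have h2 : C * (q - ρ m : ℝ)⁻¹ ≤ h (q - ρ m) := by
        simp only [h, if_neg h7', hcast]; simp
      linarith [h0 (ρ m)]
  have hsum : ∑ r ∈ Finset.range (q + 1), h r ≤ 7 * Λ + C * (1 + Real.log q) := by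
    simp only [h, Finset.sum_add_distrib, ← Finset.mul_sum]
    gcongr
    · rw [← Finset.sum_filter, Finset.sum_const, nsmul_eq_mul]
      gcongr
      have : (Finset.range (q + 1)).filter (· < 7) ⊆ Finset.range 7 := by
        intro x; simp
      exact_mod_cast (Finset.card_le_card this).trans (by simp)
    · have := harmonic_le_one_add_log q
      rw [Finset.sum_range_succ']
      simpa [harmonic] using this
  have himg : (Finset.range q).image ρ ⊆ Finset.range q := by
    intro r hr
    obtain ⟨m, -, rfl⟩ := Finset.mem_image.1 hr
    exact Finset.mem_range.2 (hρlt m)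
  calc ∑ m ∈ Finset.range q, F m
      ≤ ∑ m ∈ Finset.range q, (h (ρ m) + h (q - ρ m)) := Finset.sum_le_sum hterm
    _ = ∑ r ∈ (Finset.range q).image ρ, (h r + h (q - r)) := by
        rw [Finset.sum_image hinj]
    _ ≤ ∑ r ∈ Finset.range q, (h r + h (q - r)) :=
        Finset.sum_le_sum_of_subset_of_nonneg himg fun r _ _ ↦ add_nonneg (h0 _) (h0 _)
    _ ≤ ∑ r ∈ Finset.range (q + 1), (h r + h (q - r)) :=
        Finset.sum_le_sum_of_subset_of_nonneg (Finset.range_mono (Nat.le_succ _))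
          fun r _ _ ↦ add_nonneg (h0 _) (h0 _)
    _ = 2 * ∑ r ∈ Finset.range (q + 1), h r := by
        rw [Finset.sum_add_distrib, ← Finset.sum_range_reflect h (q + 1), two_mul]
        simp
    _ ≤ _ := by linarith

lemma exists_norm_e_sub_e_le (A : ℂ) {D : ℂ} (hD : D ≠ 0) :
    ∃ τ, ∀ t, ‖D‖ / 2 * ‖e t - e τ‖ ≤ ‖A + D * e t‖ := by
  have hD' : 0 < ‖D‖ := norm_pos_iff.2 hD
  obtain ⟨u, r, hu, hr, hA⟩ : ∃ (u : ℂ) (r : ℝ), ‖u‖ = 1 ∧ 0 ≤ r ∧ A = -(D * (r * u)) := by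
    by_cases hA : A = 0
    · exact ⟨1, 0, by simp, le_rfl, by simp [hA]⟩
    · have hA' : (‖A‖ : ℂ) ≠ 0 := by simpa using hA
      have hDD : (‖D‖ : ℂ) ≠ 0 := by simpa using hD
      refine ⟨-(A / ‖A‖) * (‖D‖ / D), ‖A‖ / ‖D‖, ?_, by positivity, ?_⟩
      · rw [norm_mul, norm_neg, norm_div, norm_div]
        simp [hA, hD]
      · push_cast
        field_simp
  obtain ⟨τ, hτ⟩ := exists_e_eq hu
  refine ⟨τ, fun t ↦ ?_⟩
  have h1 : A + D * e t = D * (e t - r * u) := by rw [hA]; ring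
  rw [h1, norm_mul, hτ]
  have h2 : ‖e t - u‖ ≤ ‖e t - r * u‖ + ‖(r - 1 : ℂ) * u‖ := by
    refine le_trans (le_of_eq ?_) (norm_add_le _ _)
    congr 1
    ring
  have h3 : ‖(r - 1 : ℂ) * u‖ ≤ ‖e t - r * u‖ := by
    have h4 := abs_norm_sub_norm_le (e t) (r * u)
    rw [norm_mul, norm_e, hu, Complex.norm_real, Real.norm_of_nonneg hr, abs_sub_comm] at h4
    rw [norm_mul, hu, mul_one, show (r - 1 : ℂ) = ((r - 1 : ℝ) : ℂ) by push_cast; rfl,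
      Complex.norm_real, Real.norm_eq_abs]
    simpa using h4
  nlinarith

/-- A trigonometric polynomial with frequencies `0`, `α` and `β`. -/
noncomputable def trinomial (c₀ c₁ c₂ : ℂ) (α β x : ℝ) : ℂ :=
  c₀ + c₁ * e (α * x) + c₂ * e (β * x)

lemma continuous_trinomial (c₀ c₁ c₂ : ℂ) (α β : ℝ) : Continuous (trinomial c₀ c₁ c₂ α β) := by
  have h1 : Continuous fun x : ℝ ↦ e (α * x) := continuous_e.comp (by fun_prop)
  have h2 : Continuous fun x : ℝ ↦ e (β * x) := continuous_e.comp (by fun_prop)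
  unfold trinomial
  fun_prop

lemma e_mul_add_div_abs {α : ℝ} (hα : α ≠ 0) (y : ℝ) (m : ℤ) :
    e (α * (y + m / |α|)) = e (α * y) := by
  rcases abs_choice α with h | h
  · rw [h, show α * (y + m / α) = α * y + m by field_simp, e_add, e_intCast, mul_one]
  · rw [h, show α * (y + m / -α) = α * y + (-m : ℤ) by push_cast; field_simp, e_add,
      e_intCast, mul_one]

lemma trinomial_add_div_abs (c₀ c₁ c₂ : ℂ) {α : ℝ} (hα : α ≠ 0) (β y : ℝ) (m : ℤ) :
    trinomial c₀ c₁ c₂ α β (y + m / |α|) =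
      (c₀ + c₁ * e (α * y)) + (c₂ * e (β * y)) * e (β / |α| * m) := by
  rw [trinomial, e_mul_add_div_abs hα, mul_assoc c₂, ← e_add]
  congr 3
  field_simp

/-- The logarithmic cost of an additive error `C / q` at a point where the trinomial has a given
size, truncated below at `μ`. -/
noncomputable def logCost (P : ℝ → ℂ) (C μ : ℝ) (q : ℕ) (x : ℝ) : ℝ :=
  Real.log (1 + C / (q * max ‖P x‖ μ))

lemma logCost_nonneg {P : ℝ → ℂ} {C μ : ℝ} (hC : 0 ≤ C) (hμ : 0 < μ) (q : ℕ) (x : ℝ) :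
    0 ≤ logCost P C μ q x := by
  have : 0 < max ‖P x‖ μ := lt_max_of_lt_right hμ
  refine Real.log_nonneg ?_
  have : 0 ≤ C / (q * max ‖P x‖ μ) := by positivity
  linarith

lemma continuous_logCost {P : ℝ → ℂ} (hP : Continuous P) {C μ : ℝ} (hC : 0 ≤ C) (hμ : 0 < μ)
    {q : ℕ} (hq : 0 < q) : Continuous (logCost P C μ q) := by
  have hq' : (0 : ℝ) < q := by exact_mod_cast hq
  have hpos : ∀ x, 0 < max ‖P x‖ μ := fun x ↦ lt_max_of_lt_right hμ
  refine Continuous.log ?_ fun x ↦ ?_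
  · refine continuous_const.add (continuous_const.div (by fun_prop) fun x ↦ ?_)
    exact (mul_pos hq' (hpos x)).ne'
  · have := hpos x
    have : 0 ≤ C / (q * max ‖P x‖ μ) := by positivity
    linarith

lemma sum_logCost_trinomial_le (c₀ c₁ : ℂ) {c₂ : ℂ} (hc₂ : c₂ ≠ 0) {α : ℝ} (hα : α ≠ 0)
    (β : ℝ) {a : ℤ} {q : ℕ} (hq : 0 < q) (ha : IsCoprime a q)
    (hγ : |β / |α| - a / q| ≤ 1 / (q : ℝ) ^ 2) {C μ : ℝ} (hC : 0 ≤ C) (hμ : 0 < μ) (y : ℝ) :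
    ∑ m ∈ Finset.range q, logCost (trinomial c₀ c₁ c₂ α β) C μ q (y + m * (1 / |α|)) ≤
      14 * Real.log (1 + C / (q * μ)) + 2 * (2 * C / ‖c₂‖) * (1 + Real.log q) := by
  have hq' : (0 : ℝ) < q := by exact_mod_cast hq
  have hc' : 0 < ‖c₂‖ := norm_pos_iff.2 hc₂
  have hD : c₂ * e (β * y) ≠ 0 := by
    rw [← norm_pos_iff, norm_mul, norm_e, mul_one]
    exact hc'
  obtain ⟨τ, hτ⟩ := exists_norm_e_sub_e_le (c₀ + c₁ * e (α * y)) hD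
  have hP : ∀ m : ℕ, ‖c₂‖ / 2 * ‖e (β / |α| * m) - e τ‖ ≤
      ‖trinomial c₀ c₁ c₂ α β (y + m * (1 / |α|))‖ := by
    intro m
    have h1 := trinomial_add_div_abs c₀ c₁ c₂ hα β y m
    rw [Int.cast_natCast, div_eq_mul_one_div (m : ℝ)] at h1
    rw [h1]
    have h2 := hτ (β / |α| * m)
    rwa [norm_mul c₂, norm_e, mul_one] at h2
  have hmax : ∀ x, 0 < max ‖trinomial c₀ c₁ c₂ α β x‖ μ := fun x ↦ lt_max_of_lt_right hμ
  refine sum_range_le_of_rational_approx hq ha hγ (τ := τ) (Real.log_nonneg ?_) (by positivity)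
    (fun m ↦ ?_) fun m hm ↦ ?_
  · have : 0 ≤ C / (q * μ) := by positivity
    linarith
  · have := hmax (y + m * (1 / |α|))
    refine Real.log_le_log (by positivity) ?_
    gcongr
    exact le_max_right _ _
  · have h1 := hmax (y + m * (1 / |α|))
    have h2 : logCost (trinomial c₀ c₁ c₂ α β) C μ q (y + m * (1 / |α|)) ≤
        C / (q * max ‖trinomial c₀ c₁ c₂ α β (y + m * (1 / |α|))‖ μ) := by
      refine (Real.log_le_sub_one_of_pos (by positivity)).trans ?_
      linarith
    refine h2.trans ?_
    have h3 : 2 * C / ‖c₂‖ / (q * ‖e (β / |α| * m) - e τ‖) =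
        C / (q * (‖c₂‖ / 2 * ‖e (β / |α| * m) - e τ‖)) := by
      field_simp
    rw [h3]
    gcongr
    exact (hP m).trans (le_max_left _ _)

lemma integral_eq_integral_sum_shift {Φ : ℝ → ℝ} (hΦ : Continuous Φ) (a h : ℝ) (N : ℕ) :
    ∫ x in a..(a + N * h), Φ x =
      ∫ y in (0 : ℝ)..h, ∑ m ∈ Finset.range N, Φ ((a + y) + m * h) := by
  have h1 := intervalIntegral.sum_integral_adjacent_intervals (f := Φ) (μ := volume)
    (a := fun k : ℕ ↦ a + k * h) (n := N) fun k _ ↦ hΦ.intervalIntegrable _ _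
  simp only [Nat.cast_zero, zero_mul, add_zero] at h1
  rw [← h1, intervalIntegral.integral_finsetSum]
  · refine Finset.sum_congr rfl fun k _ ↦ ?_
    have h2 := intervalIntegral.integral_comp_add_right (a := 0) (b := h) Φ (a + k * h)
    rw [show (0 : ℝ) + (a + k * h) = a + k * h by ring,
      show h + (a + k * h) = a + (k + 1 : ℕ) * h by push_cast; ring] at h2
    rw [← h2]
    refine intervalIntegral.integral_congr fun y _ ↦ ?_
    ring_nf
  · intro k _
    exact (hΦ.comp (by fun_prop)).intervalIntegrable _ _

/-- If the sums of `Φ` along progressions of step `T` and length `q` are at most `L`, then the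
average over `y ∈ [a, a + 1]` of the sums along integer translates is controlled by `L`. -/
lemma integral_sum_intCast_shift_le {Φ : ℝ → ℝ} (hΦ : Continuous Φ) (h0 : ∀ x, 0 ≤ Φ x)
    {T L : ℝ} (hT : 0 < T) {q M n : ℕ} (hL : ∀ y, ∑ m ∈ Finset.range q, Φ (y + m * T) ≤ L)
    (hn : (n : ℝ) ≤ M * (q * T)) (a : ℝ) :
    ∫ y in (0 : ℝ)..1, ∑ j ∈ Finset.range n, Φ ((a + y) + j) ≤ M * (T * L) := by
  have h1 := integral_eq_integral_sum_shift hΦ a 1 n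
  simp only [mul_one] at h1
  have h2 : ∫ x in a..(a + n), Φ x ≤ ∫ x in a..(a + M * (q * T)), Φ x := by
    refine intervalIntegral.integral_mono_interval le_rfl (by simp) (by linarith) ?_
      (hΦ.intervalIntegrable _ _)
    exact Filter.Eventually.of_forall h0
  have h3 : ∀ b, ∫ x in b..(b + q * T), Φ x ≤ T * L := by
    intro b
    rw [integral_eq_integral_sum_shift hΦ b T q]
    calc ∫ y in (0 : ℝ)..T, ∑ m ∈ Finset.range q, Φ ((b + y) + m * T)
        ≤ ∫ y in (0 : ℝ)..T, L := by
          refine intervalIntegral.integral_mono_on hT.le ?_ (by simp) fun y _ ↦ hL _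
          exact (continuous_finsetSum _ fun m _ ↦
            hΦ.comp (by fun_prop)).intervalIntegrable _ _
      _ = T * L := by simp
  have h4 := intervalIntegral.sum_integral_adjacent_intervals (f := Φ) (μ := volume)
    (a := fun k : ℕ ↦ a + k * (q * T)) (n := M) fun k _ ↦ hΦ.intervalIntegrable _ _
  simp only [Nat.cast_zero, zero_mul, add_zero] at h4
  rw [← h1]
  refine h2.trans ?_
  rw [← h4]
  calc _ ≤ ∑ k ∈ Finset.range M, T * L := by
        refine Finset.sum_le_sum fun k _ ↦ ?_
        have := h3 (a + k * (q * T))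
        rwa [show a + k * (q * T) + q * T = a + (k + 1 : ℕ) * (q * T) by push_cast; ring] at this
    _ = _ := by simp

lemma volume_sin_sublevel_le {α : ℝ} (hα : α ≠ 0) {a b : ℝ} (hab : |α| * (b - a) ≤ 1 / 2)
    (φ : ℝ) {ρ : ℝ} (hρ : 0 ≤ ρ) :
    volume {x ∈ Set.Icc a b | |Real.sin (Real.pi * (α * x + φ))| ≤ ρ} ≤
      ENNReal.ofReal (ρ / |α|) := by
  have hα' : 0 < |α| := abs_pos.2 hα
  refine (Real.volume_le_diam _).trans (Metric.ediam_le fun x hx y hy ↦ ?_)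
  rw [edist_dist, Real.dist_eq]
  refine ENNReal.ofReal_le_ofReal ?_
  obtain ⟨⟨hx1, hx2⟩, hx3⟩ := hx
  obtain ⟨⟨hy1, hy2⟩, hy3⟩ := hy
  have hxy : |x - y| ≤ b - a := by rw [abs_le]; constructor <;> linarith
  have hsin : |Real.sin (Real.pi * (α * (x - y)))| ≤ 2 * ρ := by
    rw [show Real.pi * (α * (x - y)) = Real.pi * (α * x + φ) - Real.pi * (α * y + φ) by ring,
      Real.sin_sub]
    refine (abs_sub _ _).trans ?_
    rw [abs_mul, abs_mul]
    have h1 := Real.abs_cos_le_one (Real.pi * (α * x + φ))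
    have h2 := Real.abs_cos_le_one (Real.pi * (α * y + φ))
    nlinarith [abs_nonneg (Real.sin (Real.pi * (α * x + φ))),
      abs_nonneg (Real.sin (Real.pi * (α * y + φ))),
      abs_nonneg (Real.cos (Real.pi * (α * x + φ))),
      abs_nonneg (Real.cos (Real.pi * (α * y + φ)))]
  have habs : |Real.pi * (α * (x - y))| = Real.pi * (|α| * |x - y|) := by
    rw [abs_mul, abs_mul, abs_of_pos Real.pi_pos]
  have hlow := Real.mul_abs_le_abs_sin (x := Real.pi * (α * (x - y))) (by
    rw [habs]
    have : |α| * |x - y| ≤ 1 / 2 := (by gcongr : _ ≤ |α| * (b - a)).trans hab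
    nlinarith [Real.pi_pos])
  rw [habs] at hlow
  have hlow' : 2 * (|α| * |x - y|) ≤ 2 * ρ := by
    refine le_trans (le_of_eq ?_) (hlow.trans hsin)
    field_simp
  rw [le_div_iff₀ hα']
  linarith

lemma volume_cos_sublevel_le {α : ℝ} (hα : α ≠ 0) {a b : ℝ} (hab : |α| * (b - a) ≤ 1 / 2)
    (φ κ : ℝ) {ε : ℝ} (hε : 0 ≤ ε) :
    volume {x ∈ Set.Icc a b | |Real.cos (2 * Real.pi * (α * x + φ)) - κ| < ε} ≤
      2 * ENNReal.ofReal (√ε / |α|) := by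
  set E := {x ∈ Set.Icc a b | |Real.cos (2 * Real.pi * (α * x + φ)) - κ| < ε} with hE
  rcases E.eq_empty_or_nonempty with h | ⟨v, hv⟩
  · simp [h]
  have hsub : E ⊆ {x ∈ Set.Icc a b | |Real.sin (Real.pi * (α * x + -(α * v)))| ≤ √ε} ∪
      {x ∈ Set.Icc a b | |Real.sin (Real.pi * (α * x + (α * v + 2 * φ)))| ≤ √ε} := by
    intro x hx
    have h1 : |Real.cos (2 * Real.pi * (α * x + φ)) - Real.cos (2 * Real.pi * (α * v + φ))| <
        2 * ε := by
      have hx2 := abs_lt.1 hx.2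
      have hv2 := abs_lt.1 hv.2
      rw [abs_lt]
      constructor <;> linarith [hx2.1, hx2.2, hv2.1, hv2.2]
    rw [Real.cos_sub_cos, show (2 * Real.pi * (α * x + φ) + 2 * Real.pi * (α * v + φ)) / 2 =
      Real.pi * (α * x + (α * v + 2 * φ)) by ring,
      show (2 * Real.pi * (α * x + φ) - 2 * Real.pi * (α * v + φ)) / 2 =
      Real.pi * (α * x + -(α * v)) by ring, abs_mul, abs_mul] at h1
    norm_num at h1
    by_contra hcon
    simp only [Set.mem_union, Set.mem_ofPred_eq, hx.1, true_and, not_or, not_le] at hcon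
    nlinarith [Real.sq_sqrt hε, Real.sqrt_nonneg ε, mul_lt_mul'' hcon.2 hcon.1
      (Real.sqrt_nonneg ε) (Real.sqrt_nonneg ε)]
  refine (measure_mono hsub).trans ((measure_union_le _ _).trans ?_)
  rw [two_mul (ENNReal.ofReal _)]
  exact add_le_add (volume_sin_sublevel_le hα hab _ (Real.sqrt_nonneg _))
    (volume_sin_sublevel_le hα hab _ (Real.sqrt_nonneg _))

lemma re_e (x : ℝ) : (e x).re = Real.cos (2 * Real.pi * x) := by
  rw [e, show (2 * Real.pi * Complex.I * x : ℂ) = ((2 * Real.pi * x : ℝ) : ℂ) * Complex.I by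
    push_cast; ring, Complex.exp_ofReal_mul_I_re]

lemma exists_volume_trinomial_sublevel_le {c₀ c₁ : ℂ} (hc₀ : c₀ ≠ 0) (hc₁ : c₁ ≠ 0) (c₂ : ℂ)
    {α : ℝ} (hα : α ≠ 0) (β : ℝ) :
    ∃ C, 0 < C ∧ ∀ a b s μ : ℝ, 0 < μ → |α| * (b - a) ≤ 1 / 2 →
      volume {x ∈ Set.Icc a b | ‖trinomial c₀ c₁ c₂ α β (x + s)‖ < μ} ≤
        2 * ENNReal.ofReal (√(C * μ) / |α|) := by
  have h0 : 0 < ‖c₀‖ := norm_pos_iff.2 hc₀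
  have h1 : 0 < ‖c₁‖ := norm_pos_iff.2 hc₁
  set M := ‖c₀‖ + ‖c₁‖ + ‖c₂‖ with hM
  have hMpos : 0 < M := by positivity
  obtain ⟨θ, hθ⟩ : ∃ θ, c₁ * starRingEnd ℂ c₀ = (‖c₀‖ * ‖c₁‖ : ℝ) * e θ := by
    have hne : ((‖c₀‖ * ‖c₁‖ : ℝ) : ℂ) ≠ 0 := by exact_mod_cast (mul_pos h0 h1).ne'
    obtain ⟨θ, hθ⟩ := exists_e_eq (z := c₁ * starRingEnd ℂ c₀ / (‖c₀‖ * ‖c₁‖ : ℝ)) (by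
      rw [norm_div, norm_mul, RCLike.norm_conj, Complex.norm_real,
        Real.norm_of_nonneg (by positivity), mul_comm]
      exact div_self (mul_pos h0 h1).ne')
    exact ⟨θ, by rw [hθ]; field_simp⟩
  have hB : ∀ t, ‖c₀ + c₁ * e t‖ ^ 2 =
      ‖c₀‖ ^ 2 + ‖c₁‖ ^ 2 + 2 * (‖c₀‖ * ‖c₁‖) * Real.cos (2 * Real.pi * (t + θ)) := by
    intro t
    have h := Complex.normSq_add (c₁ * e t) c₀
    rw [show c₁ * e t * starRingEnd ℂ c₀ = (‖c₀‖ * ‖c₁‖ : ℝ) * e (t + θ) by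
      rw [e_add, mul_right_comm, hθ]; ring, Complex.re_ofReal_mul, re_e,
      Complex.normSq_eq_norm_sq, Complex.normSq_eq_norm_sq, Complex.normSq_eq_norm_sq,
      norm_mul, norm_e, mul_one] at h
    rw [add_comm c₀, h]
    ring
  refine ⟨M / (2 * (‖c₀‖ * ‖c₁‖)), by positivity, fun a b s μ hμ hab ↦ ?_⟩
  refine le_trans (measure_mono ?_) (volume_cos_sublevel_le hα hab (α * s + θ)
    ((‖c₂‖ ^ 2 - ‖c₀‖ ^ 2 - ‖c₁‖ ^ 2) / (2 * (‖c₀‖ * ‖c₁‖))) (by positivity))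
  rintro x ⟨hx, hxμ⟩
  refine ⟨hx, ?_⟩
  have hb := hB (α * (x + s))
  set B := c₀ + c₁ * e (α * (x + s)) with hBdef
  have hBM : ‖B‖ ≤ ‖c₀‖ + ‖c₁‖ := by
    refine (norm_add_le _ _).trans ?_
    rw [norm_mul, norm_e, mul_one]
  have hlt : |‖B‖ - ‖c₂‖| < μ := by
    have h2 := abs_norm_sub_norm_le B (-(c₂ * e (β * (x + s))))
    rw [norm_neg, norm_mul, norm_e, mul_one, sub_neg_eq_add] at h2
    exact h2.trans_lt hxμ
  have hcos : Real.cos (2 * Real.pi * (α * x + (α * s + θ))) -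
      (‖c₂‖ ^ 2 - ‖c₀‖ ^ 2 - ‖c₁‖ ^ 2) / (2 * (‖c₀‖ * ‖c₁‖)) =
      ((‖B‖ - ‖c₂‖) * (‖B‖ + ‖c₂‖)) / (2 * (‖c₀‖ * ‖c₁‖)) := by
    rw [show α * x + (α * s + θ) = α * (x + s) + θ by ring]
    field_simp
    linarith
  rw [hcos, abs_div, abs_of_pos (by positivity : 0 < 2 * (‖c₀‖ * ‖c₁‖)), div_mul_eq_mul_div,
    abs_mul, abs_of_nonneg (by positivity : 0 ≤ ‖B‖ + ‖c₂‖)]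
  refine div_lt_div_of_pos_right ?_ (by positivity)
  calc |‖B‖ - ‖c₂‖| * (‖B‖ + ‖c₂‖) ≤ |‖B‖ - ‖c₂‖| * M := by
        gcongr
        linarith
    _ < μ * M := by gcongr
    _ = M * μ := mul_comm _ _

lemma not_lower_bound_of_rapid_decay {f : ℝ → ℂ}
    (hdec : ∀ A : ℕ, ∃ C, ∀ x, |x| ^ A * ‖f x‖ ≤ C) {c κ A : ℝ} (hc : 0 < c) (hκ : 0 < κ)
    (h : ∀ Q : ℝ, ∃ q : ℕ, Q ≤ q ∧ ∃ u v : ℝ, κ * q ≤ |u| ∧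
      c ≤ Real.exp (A * Real.log q) * (‖f u‖ * ‖f v‖)) : False := by
  obtain ⟨C₀, hC₀⟩ := hdec 0
  obtain ⟨C₁, hC₁⟩ := hdec (⌈A⌉₊ + 1)
  have hC₀0 : 0 ≤ C₀ := le_trans (by positivity) (hC₀ 0)
  have hC₁0 : 0 ≤ C₁ := le_trans (by positivity) (hC₁ 0)
  obtain ⟨q, hq, u, v, hu, hle⟩ := h (C₁ / κ ^ (⌈A⌉₊ + 1) * C₀ / c + 1)
  have hq1 : (1 : ℝ) ≤ q := by
    have : 0 ≤ C₁ / κ ^ (⌈A⌉₊ + 1) * C₀ / c := by positivity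
    linarith
  have hq0 : (0 : ℝ) < q := by linarith
  have hexp : Real.exp (A * Real.log q) ≤ (q : ℝ) ^ ⌈A⌉₊ := by
    rw [← Real.exp_log (pow_pos hq0 _), Real.log_pow]
    have := Real.log_nonneg hq1
    gcongr
    exact Nat.le_ceil A
  have hfv : ‖f v‖ ≤ C₀ := by simpa using hC₀ v
  have hfu : (q : ℝ) ^ (⌈A⌉₊ + 1) * ‖f u‖ ≤ C₁ / κ ^ (⌈A⌉₊ + 1) := by
    rw [le_div_iff₀ (by positivity)]
    calc (q : ℝ) ^ (⌈A⌉₊ + 1) * ‖f u‖ * κ ^ (⌈A⌉₊ + 1) = (κ * q) ^ (⌈A⌉₊ + 1) * ‖f u‖ := by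
          rw [mul_pow]; ring
      _ ≤ |u| ^ (⌈A⌉₊ + 1) * ‖f u‖ := by gcongr
      _ ≤ C₁ := hC₁ u
  have h1 : c * q ≤ C₁ / κ ^ (⌈A⌉₊ + 1) * C₀ := by
    calc c * q ≤ (q : ℝ) ^ ⌈A⌉₊ * (‖f u‖ * ‖f v‖) * q := by
          gcongr
          exact hle.trans (by gcongr)
      _ = (q : ℝ) ^ (⌈A⌉₊ + 1) * ‖f u‖ * ‖f v‖ := by ring
      _ ≤ _ := by gcongr
  have h2 : (q : ℝ) ≤ C₁ / κ ^ (⌈A⌉₊ + 1) * C₀ / c := by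
    rw [le_div_iff₀ hc]
    linarith
  linarith

lemma norm_add_natCast_eq_prod {f P : ℝ → ℂ} (hrec : ∀ x, ‖f (x + 1)‖ = ‖f x‖ * ‖P x‖) (x : ℝ)
    (n : ℕ) : ‖f (x + n)‖ = ‖f x‖ * ∏ j ∈ Finset.range n, ‖P (x + j)‖ := by
  induction n with
  | zero => simp
  | succ n ih =>
    rw [Finset.prod_range_succ, ← mul_assoc, ← ih, ← hrec]
    congr 2
    push_cast
    ring

/-- Comparing the orbits of `x` and `x - S` under the unit translation. -/
lemma norm_mul_norm_le_of_shift {f P : ℝ → ℂ} (hrec : ∀ x, ‖f (x + 1)‖ = ‖f x‖ * ‖P x‖)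
    {x S : ℝ} {n : ℕ} {F : ℕ → ℝ}
    (hF : ∀ j < n, ‖P (x - S + j)‖ ≤ ‖P (x + j)‖ * Real.exp (F j)) :
    ‖f (x - S + n)‖ * ‖f x‖ ≤
      Real.exp (∑ j ∈ Finset.range n, F j) * (‖f (x - S)‖ * ‖f (x + n)‖) := by
  rw [norm_add_natCast_eq_prod hrec (x - S), norm_add_natCast_eq_prod hrec x, Real.exp_sum]
  have h : ∏ j ∈ Finset.range n, ‖P (x - S + j)‖ ≤
      (∏ j ∈ Finset.range n, ‖P (x + j)‖) * ∏ j ∈ Finset.range n, Real.exp (F j) := by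
    rw [← Finset.prod_mul_distrib]
    exact Finset.prod_le_prod (fun _ _ ↦ norm_nonneg _) fun j hj ↦ hF j (Finset.mem_range.1 hj)
  calc _ ≤ ‖f (x - S)‖ * ((∏ j ∈ Finset.range n, ‖P (x + j)‖) *
        ∏ j ∈ Finset.range n, Real.exp (F j)) * ‖f x‖ := by gcongr
    _ = _ := by ring

lemma exists_nat_abs_mul_sub_le {η : ℝ} (hη : 0 < η) :
    ∃ K : ℕ, ∀ ξ : ℝ, 0 ≤ ξ → ∃ k n : ℕ, 0 < k ∧ k ≤ K ∧ |k * ξ - n| ≤ η := by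
  obtain ⟨K, hK⟩ := exists_nat_one_div_lt hη
  refine ⟨K + 1, fun ξ hξ ↦ ?_⟩
  obtain ⟨j, k, hk0, hkK, hle⟩ := Real.exists_int_int_abs_mul_sub_le ξ (Nat.succ_pos K)
  have h1 : (1 : ℝ) / ((K.succ : ℕ) + 1) ≤ 1 / (K + 1) := by
    push_cast
    gcongr
    linarith
  have hlt : (1 : ℝ) / ((K.succ : ℕ) + 1) < 1 := by
    rw [div_lt_one (by positivity)]
    push_cast
    have : (0 : ℝ) ≤ K := Nat.cast_nonneg K
    linarith
  have hj : 0 ≤ j := by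
    by_contra hcon
    have hj1 : (j : ℝ) ≤ -1 := by exact_mod_cast (by omega : j ≤ -1)
    have hk' : (0 : ℝ) ≤ k * ξ := mul_nonneg (by exact_mod_cast hk0.le) hξ
    have := (abs_le.1 hle).2
    linarith
  lift j to ℕ using hj
  lift k to ℕ using hk0.le
  refine ⟨k, j, by exact_mod_cast hk0, by exact_mod_cast hkK, ?_⟩
  simp only [Int.cast_natCast] at hle
  linarith

lemma exists_norm_lower_bound {f : ℝ → ℂ} (hf : Continuous f) {x₀ : ℝ} (hx₀ : f x₀ ≠ 0) :
    ∃ δ c, 0 < δ ∧ 0 < c ∧ ∀ x, |x - x₀| ≤ δ → c ≤ ‖f x‖ := by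
  have h0 : 0 < ‖f x₀‖ := norm_pos_iff.2 hx₀
  obtain ⟨δ, hδ, h⟩ := Metric.continuous_iff.1 hf.norm x₀ (‖f x₀‖ / 2) (by positivity)
  refine ⟨δ / 2, ‖f x₀‖ / 2, by positivity, by positivity, fun x hx ↦ ?_⟩
  have := h x (by rw [Real.dist_eq]; linarith)
  rw [Real.dist_eq] at this
  linarith [(abs_lt.1 this).1]

lemma eq_zero_of_periodic_norm {f P : ℝ → ℂ} (hf : Continuous f)
    (hdec : ∀ A : ℕ, ∃ C, ∀ x, |x| ^ A * ‖f x‖ ≤ C)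
    (hrec : ∀ x, ‖f (x + 1)‖ = ‖f x‖ * ‖P x‖) {S : ℝ} (hS : 0 < S)
    (hper : Function.Periodic (fun x ↦ ‖P x‖) S) (x₀ : ℝ) : f x₀ = 0 := by
  by_contra hx₀
  obtain ⟨δ, c, hδ, hc, hlow⟩ := exists_norm_lower_bound hf hx₀
  obtain ⟨K, hK⟩ := exists_nat_abs_mul_sub_le hδ
  refine not_lower_bound_of_rapid_decay hdec (c := c * c) (κ := S / 2) (A := 0) (by positivity)
    (by positivity) fun Q ↦ ?_
  obtain ⟨Q', hQ'⟩ := exists_nat_ge (max Q (2 * |x₀| / S))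
  obtain ⟨k, n, hk0, -, hkn⟩ := hK (Q' * S) (by positivity)
  have hk1 : (1 : ℝ) ≤ k := by exact_mod_cast hk0
  have hqQ : (Q' : ℝ) ≤ (k * Q' : ℕ) := by
    push_cast
    nlinarith [(Nat.cast_nonneg Q' : (0 : ℝ) ≤ Q')]
  refine ⟨k * Q', (le_max_left _ _).trans (hQ'.trans hqQ), x₀ - (k * Q' : ℕ) * S, x₀ + n, ?_, ?_⟩
  · have h1 : 2 * |x₀| ≤ (k * Q' : ℕ) * S := by
      rw [← div_le_iff₀ hS]
      exact (le_max_right _ _).trans (hQ'.trans hqQ)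
    rw [abs_sub_comm]
    refine le_trans ?_ (le_abs_self _)
    linarith [le_abs_self x₀]
  · have h1 := norm_mul_norm_le_of_shift hrec (x := x₀) (S := (k * Q' : ℕ) * S) (n := n)
      (F := fun _ ↦ 0) fun j _ ↦ by
        have := hper.sub_nat_mul_eq (x := x₀ + j) (k * Q')
        rw [show x₀ - (k * Q' : ℕ) * S + j = x₀ + j - (k * Q' : ℕ) * S by ring, this]
        simp
    simp only [Finset.sum_const_zero] at h1
    rw [zero_mul]
    refine le_trans ?_ h1
    refine mul_le_mul (hlow _ ?_) (hlow _ (by simpa using hδ.le)) hc.le (norm_nonneg _)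
    rw [← abs_neg]
    convert hkn using 2
    push_cast
    ring

lemma exists_rat_approx_den_ge {γ : ℝ} (hγ : Irrational γ) (Q : ℝ) :
    ∃ (a : ℤ) (q : ℕ), Q ≤ q ∧ 0 < q ∧ IsCoprime a q ∧ |γ - a / q| ≤ 1 / (q : ℝ) ^ 2 := by
  by_contra! hcon
  obtain ⟨N, hN⟩ := exists_nat_ge Q
  refine Real.infinite_rat_abs_sub_lt_one_div_den_sq_of_irrational hγ ?_
  obtain ⟨B, hB⟩ := exists_nat_ge ((|γ| + 1) * N)
  refine Set.Finite.of_finite_image (f := fun r : ℚ ↦ (r.num, r.den)) ?_ ?_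
  · refine ((Set.finite_Icc (-(B : ℤ)) B).prod (Set.finite_Iic N)).subset ?_
    rintro _ ⟨r, hr, rfl⟩
    simp only [Set.mem_ofPred_eq] at hr
    have hden : (0 : ℝ) < r.den := by exact_mod_cast r.den_pos
    have hr' : (r : ℝ) = r.num / r.den := by exact_mod_cast (Rat.num_div_den r).symm
    have hlt : r.den ≤ N := by
      by_contra hlt
      have h1 : Q ≤ r.den := hN.trans (by exact_mod_cast (not_le.1 hlt).le)
      have h2 := hcon r.num r.den h1 r.den_pos (by
        rw [Int.isCoprime_iff_gcd_eq_one]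
        exact r.reduced)
      rw [← hr'] at h2
      linarith
    have hr1 : |γ - r| < 1 := by
      refine hr.trans_le ?_
      rw [div_le_one (by positivity)]
      exact one_le_pow₀ (by exact_mod_cast r.den_pos)
    have hnum : |(r.num : ℝ)| ≤ B := by
      have h3 : (r.num : ℝ) = r * r.den := by rw [hr']; field_simp
      have h4 : |(r : ℝ)| ≤ |γ| + 1 := by
        rw [show (r : ℝ) = γ - (γ - r) by ring]
        exact (abs_sub _ _).trans (by linarith)
      rw [h3, abs_mul, abs_of_pos hden]
      refine le_trans ?_ hB
      gcongr
    have := abs_le.1 (by exact_mod_cast hnum : |r.num| ≤ (B : ℤ))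
    exact ⟨⟨this.1, this.2⟩, hlt⟩
  · intro r _ s _ hrs
    simp only [Prod.mk.injEq] at hrs
    exact Rat.ext hrs.1 hrs.2

lemma exists_point_sum_logCost_le {c₀ c₁ c₂ : ℂ} (hc₀ : c₀ ≠ 0) (hc₁ : c₁ ≠ 0) (hc₂ : c₂ ≠ 0)
    {α : ℝ} (hα : α ≠ 0) (β : ℝ) (x₀ : ℝ) {η : ℝ} (hη : 0 < η) (hη1 : 2 * η ≤ 1)
    (hηα : |α| * (2 * η) ≤ 1 / 2) {C : ℝ} (hC : 0 ≤ C) (M : ℕ) :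
    ∃ V Q : ℝ, ∀ (a : ℤ) (q : ℕ), Q ≤ q → 0 < q → IsCoprime a q →
      |β / |α| - a / q| ≤ 1 / (q : ℝ) ^ 2 → ∀ n : ℕ, (n : ℝ) ≤ M * (q * (1 / |α|)) →
      ∃ x, |x - x₀| ≤ η ∧ (∀ j < n, 1 / (q : ℝ) ^ 4 ≤ ‖trinomial c₀ c₁ c₂ α β (x + j)‖) ∧
        ∑ j ∈ Finset.range n, logCost (trinomial c₀ c₁ c₂ α β) C (1 / (q : ℝ) ^ 4) q (x + j) ≤
          V * Real.log q := by
  obtain ⟨Cs, hCs, hsub⟩ := exists_volume_trinomial_sublevel_le hc₀ hc₁ c₂ hα β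
  have hα' : 0 < |α| := abs_pos.2 hα
  have hc' : 0 < ‖c₂‖ := norm_pos_iff.2 hc₂
  refine ⟨M * (1 / |α| * (56 + 8 * C / ‖c₂‖)) / η,
    max 3 (max (1 + C) (2 * M * √Cs / (|α| ^ 2 * η))), fun a q hQ hq ha hγ n hn ↦ ?_⟩
  set P := trinomial c₀ c₁ c₂ α β with hP
  have hPc : Continuous P := continuous_trinomial _ _ _ _ _
  have hq' : (0 : ℝ) < q := by exact_mod_cast hq
  have hq3 : (3 : ℝ) ≤ q := (le_max_left _ _).trans hQ
  have hqC : 1 + C ≤ q := (le_max_left _ _).trans ((le_max_right _ _).trans hQ)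
  have hqM : 2 * M * √Cs / (|α| ^ 2 * η) ≤ q :=
    (le_max_right _ _).trans ((le_max_right _ _).trans hQ)
  set μ : ℝ := 1 / (q : ℝ) ^ 4 with hμdef
  have hμ : 0 < μ := by positivity
  have hlog1 : 1 ≤ Real.log q := by
    rw [Real.le_log_iff_exp_le hq']
    linarith [Real.exp_one_lt_d9]
  set Φ := logCost P C μ q with hΦdef
  have hΦ : Continuous Φ := continuous_logCost hPc hC hμ hq
  have hΦ0 : ∀ x, 0 ≤ Φ x := logCost_nonneg hC hμ q
  set L := (56 + 8 * C / ‖c₂‖) * Real.log q with hLdef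
  have hL : ∀ y, ∑ m ∈ Finset.range q, Φ (y + m * (1 / |α|)) ≤ L := by
    intro y
    refine (sum_logCost_trinomial_le c₀ c₁ hc₂ hα β hq ha hγ hC hμ y).trans ?_
    have h1 : Real.log (1 + C / (q * μ)) ≤ 4 * Real.log q := by
      rw [show (4 : ℝ) = ((4 : ℕ) : ℝ) by norm_num, ← Real.log_pow]
      refine Real.log_le_log (by positivity) ?_
      have : C / (q * μ) = C * (q : ℝ) ^ 3 := by rw [hμdef]; field_simp
      rw [this]
      have h2 : (1 : ℝ) ≤ (q : ℝ) ^ 3 := one_le_pow₀ (by linarith)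
      nlinarith
    have h2 : 2 * (2 * C / ‖c₂‖) * (1 + Real.log q) ≤ 2 * (2 * C / ‖c₂‖) * (2 * Real.log q) := by
      gcongr
      linarith
    have h3 : 2 * (2 * C / ‖c₂‖) * (2 * Real.log q) = 8 * C / ‖c₂‖ * Real.log q := by ring
    rw [hLdef, add_mul]
    linarith
  have hInt := integral_sum_intCast_shift_le hΦ hΦ0 (T := 1 / |α|) (by positivity) hL hn (x₀ - η)
  set g : ℝ → ℝ := fun x ↦ ∑ j ∈ Finset.range n, Φ (x + j) with hg
  have hgc : Continuous g := continuous_finsetSum _ fun j _ ↦ hΦ.comp (by fun_prop)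
  have hg0 : ∀ x, 0 ≤ g x := fun x ↦ Finset.sum_nonneg fun j _ ↦ hΦ0 _
  set I := Set.Icc (x₀ - η) (x₀ + η) with hI
  have hgI : ∫ x in I, g x ≤ M * (1 / |α| * L) := by
    have h1 := intervalIntegral.integral_comp_add_left (a := 0) (b := 1) g (x₀ - η)
    rw [hI, integral_Icc_eq_integral_Ioc,
      ← intervalIntegral.integral_of_le (by linarith : x₀ - η ≤ x₀ + η)]
    calc ∫ x in (x₀ - η)..(x₀ + η), g x ≤ ∫ x in (x₀ - η + 0)..(x₀ - η + 1), g x :=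
          intervalIntegral.integral_mono_interval (by linarith) (by linarith) (by linarith)
            (Filter.Eventually.of_forall hg0) (hgc.intervalIntegrable _ _)
      _ ≤ _ := by
          rw [← h1]
          exact hInt
  set B := ⋃ j ∈ Finset.range n, {x ∈ I | ‖P (x + j)‖ < μ} with hB
  have hBvol : volume B ≤ ENNReal.ofReal η := by
    have h1 : ∀ j : ℕ, volume {x ∈ I | ‖P (x + j)‖ < μ} ≤
        2 * ENNReal.ofReal (√(Cs * μ) / |α|) := fun j ↦
      hsub _ _ j μ hμ (by rw [show x₀ + η - (x₀ - η) = 2 * η by ring]; exact hηα)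
    calc volume B ≤ ∑ j ∈ Finset.range n, volume {x ∈ I | ‖P (x + j)‖ < μ} :=
          measure_biUnion_finset_le _ _
      _ ≤ ∑ j ∈ Finset.range n, 2 * ENNReal.ofReal (√(Cs * μ) / |α|) :=
          Finset.sum_le_sum fun j _ ↦ h1 j
      _ = ENNReal.ofReal (n * (2 * (√(Cs * μ) / |α|))) := by
          rw [Finset.sum_const, Finset.card_range, nsmul_eq_mul,
            ENNReal.ofReal_mul (by positivity), ENNReal.ofReal_mul (by positivity)]
          simp
      _ ≤ ENNReal.ofReal η := by
          refine ENNReal.ofReal_le_ofReal ?_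
          have h2 : √(Cs * μ) = √Cs / (q : ℝ) ^ 2 := by
            rw [hμdef, Real.sqrt_mul hCs.le, Real.sqrt_div zero_le_one, Real.sqrt_one,
              show (q : ℝ) ^ 4 = ((q : ℝ) ^ 2) ^ 2 by ring, Real.sqrt_sq (by positivity)]
            ring
          rw [h2]
          rw [div_le_iff₀ (by positivity)] at hqM
          calc n * (2 * (√Cs / (q : ℝ) ^ 2 / |α|))
              ≤ M * (q * (1 / |α|)) * (2 * (√Cs / (q : ℝ) ^ 2 / |α|)) := by gcongr
            _ = 2 * M * √Cs / (q * |α| ^ 2) := by field_simp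
            _ ≤ q * (|α| ^ 2 * η) / (q * |α| ^ 2) := by gcongr
            _ = η := by field_simp
  have hBmeas : MeasurableSet B := by
    refine Finset.measurableSet_biUnion _ fun j _ ↦ measurableSet_Icc.inter ?_
    exact (isOpen_lt (hPc.comp (continuous_add_const (j : ℝ))).norm
      continuous_const).measurableSet
  have hIvol : volume I = ENNReal.ofReal (2 * η) := by
    rw [hI, Real.volume_Icc]
    congr 1
    ring
  have hGvol : ENNReal.ofReal η ≤ volume (I \ B) := by
    refine le_trans ?_ le_measure_sdiff
    rw [hIvol]
    refine le_trans ?_ (tsub_le_tsub_left hBvol _)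
    rw [← ENNReal.ofReal_sub _ hη.le]
    exact ENNReal.ofReal_le_ofReal (by linarith)
  have hGtop : volume (I \ B) ≠ ⊤ :=
    ((measure_mono Set.sdiff_subset).trans_lt (by rw [hIvol]; exact ENNReal.ofReal_lt_top)).ne
  have hGreal : η ≤ volume.real (I \ B) := (ENNReal.ofReal_le_iff_le_toReal hGtop).1 hGvol
  have hgint : IntegrableOn g I := hgc.continuousOn.integrableOn_Icc
  obtain ⟨x, hx, hxle⟩ := exists_le_setAverage (μ := volume) (s := I \ B) (f := g)
    (fun h ↦ by simp [h, hη.not_ge] at hGvol) hGtop (hgint.mono_set Set.sdiff_subset)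
  refine ⟨x, ?_, fun j hj ↦ ?_, hxle.trans ?_⟩
  · have := hx.1
    rw [abs_le]
    constructor <;> linarith [this.1, this.2]
  · by_contra hcon
    exact hx.2 (Set.mem_biUnion (Finset.mem_coe.2 (Finset.mem_range.2 hj)) ⟨hx.1, not_le.1 hcon⟩)
  · have hGle : ∫ x in I \ B, g x ≤ M * (1 / |α| * L) :=
      (setIntegral_mono_set hgint (Filter.Eventually.of_forall hg0)
        (Filter.Eventually.of_forall fun _ h ↦ h.1)).trans hgI
    have hLpos : 0 ≤ L := by positivity
    rw [setAverage_eq, smul_eq_mul, inv_mul_eq_div]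
    calc _ ≤ M * (1 / |α| * L) / η := by gcongr
      _ = _ := by rw [hLdef]; ring

lemma norm_trinomial_sub_le (c₀ c₁ c₂ : ℂ) {α : ℝ} (hα : α ≠ 0) (β : ℝ) {a : ℤ} {q : ℕ}
    (hq : 0 < q) (hγ : |β / |α| - a / q| ≤ 1 / (q : ℝ) ^ 2) {k K : ℕ} (hk : k ≤ K) (x : ℝ) :
    ‖trinomial c₀ c₁ c₂ α β (x - k * (q * (1 / |α|)))‖ ≤
      ‖trinomial c₀ c₁ c₂ α β x‖ + 2 * Real.pi * ‖c₂‖ * K / q := by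
  have hq' : (0 : ℝ) < q := by exact_mod_cast hq
  have h1 := trinomial_add_div_abs c₀ c₁ c₂ hα β x (-(k * q : ℕ))
  have h2 : e (β / |α| * (-(k * q : ℕ) : ℤ)) = e (k * (a - β / |α| * q)) := by
    have : (k * (a - β / |α| * q) : ℝ) = β / |α| * (-(k * q : ℕ) : ℤ) + (k * a : ℤ) := by
      push_cast
      ring
    rw [this, e_add, e_intCast, mul_one]
  rw [h2] at h1
  have h3 : trinomial c₀ c₁ c₂ α β (x - k * (q * (1 / |α|))) = trinomial c₀ c₁ c₂ α β x +
      (c₂ * e (β * x)) * (e (k * (a - β / |α| * q)) - 1) := by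
    rw [show x - k * (q * (1 / |α|)) = x + ((-(k * q : ℕ) : ℤ) : ℝ) / |α| by push_cast; ring, h1,
      trinomial]
    ring
  rw [h3]
  refine (norm_add_le _ _).trans ?_
  gcongr
  rw [norm_mul, norm_mul, norm_e, mul_one]
  have h4 := norm_e_sub_one_le (k * (a - β / |α| * q))
  have h5 : |(k : ℝ) * (a - β / |α| * q)| ≤ K / q := by
    rw [show (k : ℝ) * (a - β / |α| * q) = -(k * q * (β / |α| - a / q)) by field_simp; ring,
      abs_neg, abs_mul, abs_of_nonneg (by positivity)]
    calc (k * q : ℝ) * |β / |α| - a / q| ≤ K * q * (1 / (q : ℝ) ^ 2) := by gcongr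
      _ = K / q := by field_simp
  calc ‖c₂‖ * ‖e (k * (a - β / |α| * q)) - 1‖ ≤ ‖c₂‖ * (2 * Real.pi * (K / q)) := by
        gcongr
        exact h4.trans (by gcongr)
    _ = _ := by ring

lemma eq_zero_of_irrational {f : ℝ → ℂ} (hf : Continuous f)
    (hdec : ∀ A : ℕ, ∃ C, ∀ x, |x| ^ A * ‖f x‖ ≤ C) {c₀ c₁ c₂ : ℂ} (hc₀ : c₀ ≠ 0)
    (hc₁ : c₁ ≠ 0) (hc₂ : c₂ ≠ 0) {α β : ℝ} (hα : α ≠ 0) (hγ : Irrational (β / |α|))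
    (hrec : ∀ x, ‖f (x + 1)‖ = ‖f x‖ * ‖trinomial c₀ c₁ c₂ α β x‖) (x₀ : ℝ) : f x₀ = 0 := by
  by_contra hx₀
  have hα' : 0 < |α| := abs_pos.2 hα
  obtain ⟨δ, c, hδ, hc, hlow⟩ := exists_norm_lower_bound hf hx₀
  obtain ⟨η, hη, hηδ, hη1, hηα⟩ :
      ∃ η : ℝ, 0 < η ∧ 2 * η ≤ δ ∧ 2 * η ≤ 1 ∧ |α| * (2 * η) ≤ 1 / 2 := by
    refine ⟨min (δ / 2) (min (1 / 2) (1 / (4 * |α|))), by positivity, ?_, ?_, ?_⟩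
    · linarith [min_le_left (δ / 2) (min (1 / 2) (1 / (4 * |α|)))]
    · linarith [(min_le_right (δ / 2) (min (1 / 2) (1 / (4 * |α|)))).trans (min_le_left _ _)]
    · calc |α| * (2 * min (δ / 2) (min (1 / 2) (1 / (4 * |α|))))
          ≤ |α| * (2 * (1 / (4 * |α|))) := by
            gcongr
            exact (min_le_right _ _).trans (min_le_right _ _)
        _ = 1 / 2 := by field_simp; norm_num
  obtain ⟨K, hK⟩ := exists_nat_abs_mul_sub_le hη
  set C := 2 * Real.pi * ‖c₂‖ * K with hC
  have hC0 : 0 ≤ C := by positivity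
  obtain ⟨V, Q, hVQ⟩ := exists_point_sum_logCost_le hc₀ hc₁ hc₂ hα β x₀ hη hη1 hηα hC0 (K + 1)
  refine not_lower_bound_of_rapid_decay hdec (c := c * c) (κ := 1 / |α| / 2) (A := V)
    (by positivity) (by positivity) fun Q' ↦ ?_
  obtain ⟨a, q, hq, hq0, ha, haq⟩ := exists_rat_approx_den_ge hγ
    (max Q' (max Q (max |α| (2 * (|x₀| + η) * |α|))))
  simp only [max_le_iff] at hq
  obtain ⟨hqQ', hqQ, hqα, hqx⟩ := hq
  have hq' : (0 : ℝ) < q := by exact_mod_cast hq0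
  obtain ⟨k, n, hk0, hkK, hkn⟩ := hK (q * (1 / |α|)) (by positivity)
  have hk1 : (1 : ℝ) ≤ k := by exact_mod_cast hk0
  have hkK' : (k : ℝ) ≤ K := by exact_mod_cast hkK
  have hqT : 1 ≤ q * (1 / |α|) := by
    rw [mul_one_div, le_div_iff₀ hα']
    linarith
  have hn : (n : ℝ) ≤ (K + 1 : ℕ) * (q * (1 / |α|)) := by
    push_cast
    nlinarith [(abs_le.1 hkn).1]
  obtain ⟨x, hx, hxμ, hxsum⟩ := hVQ a q hqQ hq0 ha haq n hn
  refine ⟨q, hqQ', x - k * (q * (1 / |α|)), x + n, ?_, ?_⟩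
  · have h1 : |x| ≤ |x₀| + η := by
      have := abs_add_le x₀ (x - x₀)
      rw [add_sub_cancel] at this
      linarith
    have h2 : 2 * (|x₀| + η) ≤ q * (1 / |α|) := by
      rw [mul_one_div, le_div_iff₀ hα']
      exact hqx
    rw [abs_sub_comm]
    refine le_trans ?_ (le_abs_self _)
    nlinarith [le_abs_self x]
  · have h1 := norm_mul_norm_le_of_shift hrec (x := x) (S := k * (q * (1 / |α|))) (n := n)
      (F := fun j ↦ logCost (trinomial c₀ c₁ c₂ α β) C (1 / (q : ℝ) ^ 4) q (x + j))
      fun j hj ↦ by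
        have h2 := norm_trinomial_sub_le c₀ c₁ c₂ hα β hq0 haq hkK (x + j)
        have h3 := hxμ j hj
        have h4 : 0 < ‖trinomial c₀ c₁ c₂ α β (x + j)‖ := lt_of_lt_of_le (by positivity) h3
        rw [logCost, max_eq_left h3, Real.exp_log (by positivity),
          show x - k * (q * (1 / |α|)) + j = x + j - k * (q * (1 / |α|)) by ring]
        refine h2.trans (le_of_eq ?_)
        rw [← hC]
        field_simp
    have h5 : c * c ≤ ‖f (x - k * (q * (1 / |α|)) + n)‖ * ‖f x‖ := by
      refine mul_le_mul (hlow _ ?_) (hlow _ (by linarith)) hc.le (norm_nonneg _)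
      rw [show x - k * (q * (1 / |α|)) + n - x₀ = (x - x₀) - (k * (q * (1 / |α|)) - n) by ring]
      exact (abs_sub _ _).trans (by linarith)
    refine h5.trans (h1.trans ?_)
    gcongr

lemma eq_zero_of_trinomial_recurrence {f : ℝ → ℂ} (hf : Continuous f)
    (hdec : ∀ A : ℕ, ∃ C, ∀ x, |x| ^ A * ‖f x‖ ≤ C) (c₀ c₁ c₂ : ℂ) {α β : ℝ} (hα : α ≠ 0)
    (hβ : β ≠ 0) (hαβ : α ≠ β)
    (hrec : ∀ x, ‖f (x + 1)‖ = ‖f x‖ * ‖trinomial c₀ c₁ c₂ α β x‖) (x₀ : ℝ) : f x₀ = 0 := by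
  have key : ∀ {γ : ℝ}, γ ≠ 0 → ∀ x, e (γ * (x + 1 / |γ|)) = e (γ * x) := fun hγ x ↦ by
    simpa using e_mul_add_div_abs hγ x 1
  by_cases hc₂ : c₂ = 0
  · refine eq_zero_of_periodic_norm hf hdec hrec (S := 1 / |α|) (by positivity) (fun x ↦ ?_) x₀
    simp only [trinomial, hc₂, key hα, zero_mul]
  by_cases hc₁ : c₁ = 0
  · refine eq_zero_of_periodic_norm hf hdec hrec (S := 1 / |β|) (by positivity) (fun x ↦ ?_) x₀
    simp only [trinomial, hc₁, key hβ, zero_mul]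
  by_cases hc₀ : c₀ = 0
  · have hsub : β - α ≠ 0 := sub_ne_zero.2 hαβ.symm
    refine eq_zero_of_periodic_norm hf hdec hrec (S := 1 / |β - α|) (by positivity)
      (fun x ↦ ?_) x₀
    have h1 : ∀ y, ‖trinomial c₀ c₁ c₂ α β y‖ = ‖c₁ + c₂ * e ((β - α) * y)‖ := fun y ↦ by
      have : trinomial c₀ c₁ c₂ α β y = e (α * y) * (c₁ + c₂ * e ((β - α) * y)) := by
        rw [mul_add, mul_left_comm _ c₂, ← e_add, trinomial, hc₀]
        ring_nf
      rw [this, norm_mul, norm_e, one_mul]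
    simp only [h1, key hsub]
  by_cases hγ : Irrational (β / |α|)
  · exact eq_zero_of_irrational hf hdec hc₀ hc₁ hc₂ hα hγ hrec x₀
  obtain ⟨r, hr⟩ := not_not.1 hγ
  have hα' : 0 < |α| := abs_pos.2 hα
  have hden : (0 : ℝ) < r.den := by exact_mod_cast r.pos
  refine eq_zero_of_periodic_norm hf hdec hrec (S := (r.den : ℤ) / |α|) (by positivity)
    (fun x ↦ ?_) x₀
  have h1 : e (β * (x + (r.den : ℤ) / |α|)) = e (β * x) := by
    have : β * (x + (r.den : ℤ) / |α|) = β * x + (r.num : ℤ) := by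
      have h2 : (r : ℝ) * r.den = r.num := by exact_mod_cast r.mul_den_eq_num
      rw [mul_add, mul_div_left_comm, mul_comm _ (β / _), ← h2, hr]
      simp
    rw [this, e_add, e_intCast, mul_one]
  simp only [trinomial, e_mul_add_div_abs hα, h1]

lemma eq_zero_of_sum_mul_e_eventually_eq_zero {n : ℕ} {ξ : Fin n → ℝ} (hξ : Function.Injective ξ)
    {d : Fin n → ℂ} {y : ℝ} (h : ∀ᶠ x in nhds y, ∑ i, d i * e (ξ i * x) = 0) (i : Fin n) :
    d i = 0 := by
  have hana : AnalyticOnNhd ℝ (fun x : ℝ ↦ ∑ i, d i * e (ξ i * x)) Set.univ := by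
    have h1 : ∀ i, AnalyticOnNhd ℝ (fun x : ℝ ↦ d i * e (ξ i * x)) Set.univ := fun i x _ ↦ by
      have h2 : AnalyticAt ℝ (fun x : ℝ ↦ 2 * Real.pi * Complex.I * ((ξ i * x : ℝ) : ℂ)) x := by
        have h3 : AnalyticAt ℝ (fun x : ℝ ↦ ((ξ i * x : ℝ) : ℂ)) x :=
          (Complex.ofRealCLM.analyticAt _).comp (f := fun x : ℝ ↦ ξ i * x)
            (analyticAt_const.mul analyticAt_id)
        exact analyticAt_const.mul h3
      exact analyticAt_const.mul (analyticAt_cexp.restrictScalars.fun_comp h2)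
    exact fun x hx ↦ Finset.analyticAt_fun_sum _ fun i _ ↦ h1 i x hx
  have hzero := hana.eqOn_zero_of_preconnected_of_eventuallyEq_zero isPreconnected_univ
    (Set.mem_univ y) h
  let χ : Fin n → (Multiplicative ℝ →* ℂ) := fun i ↦
    { toFun := fun x ↦ e (ξ i * x.toAdd)
      map_one' := by simp [e]
      map_mul' := fun x y ↦ by simp [mul_add, e_add] }
  have hχ : Function.Injective χ := fun i j hij ↦ by
    by_contra hne
    have h1 : ∀ x, e (ξ i * x) = e (ξ j * x) := fun x ↦
      DFunLike.congr_fun hij (Multiplicative.ofAdd x)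
    have h2 : ξ i - ξ j ≠ 0 := sub_ne_zero.2 (hξ.ne hne)
    have h3 := norm_e_sub_e (ξ i * (1 / 2 / (ξ i - ξ j))) (ξ j * (1 / 2 / (ξ i - ξ j)))
    rw [h1, sub_self, norm_zero, ← sub_mul, mul_div_cancel₀ _ h2] at h3
    have h4 := le_norm_e_sub_one (x := 1 / 2) (by norm_num) (by norm_num)
    rw [← h3] at h4
    norm_num at h4
  have hli := (linearIndependent_monoidHom (Multiplicative ℝ) ℂ).comp χ hχ
  rw [Fintype.linearIndependent_iff] at hli
  refine hli d ?_ i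
  funext x
  have := hzero (Set.mem_univ x.toAdd)
  simpa [χ] using this

lemma eq_zero_of_three_modulations {f : ℝ → ℂ} (hf : Continuous f)
    (hdec : ∀ A : ℕ, ∃ C, ∀ x, |x| ^ A * ‖f x‖ ≤ C) {ξ : Fin 3 → ℝ} (hξ : Function.Injective ξ)
    {d : Fin 3 → ℂ} {d' : ℂ} (hd : d' ≠ 0 ∨ ∃ i, d i ≠ 0) {s t : ℝ} (hst : s ≠ t) (ξ' : ℝ)
    (h : ∀ x, (∑ i, d i * e (ξ i * x)) * f (x + s) + d' * e (ξ' * x) * f (x + t) = 0)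
    (x₀ : ℝ) : f x₀ = 0 := by
  by_cases hd' : d' = 0
  · by_contra hx₀
    obtain ⟨i, hi⟩ := hd.resolve_left (not_not.2 hd')
    refine hi (eq_zero_of_sum_mul_e_eventually_eq_zero hξ (y := x₀ - s) ?_ i)
    have h1 : ContinuousAt (fun x ↦ f (x + s)) (x₀ - s) :=
      (hf.comp (continuous_add_const s)).continuousAt
    filter_upwards [h1.eventually_ne (by simpa using hx₀)] with x hx
    simpa [hd', hx] using h x
  · have hτ : t - s ≠ 0 := sub_ne_zero.2 hst.symm
    set τ := t - s with hτdef
    have key := eq_zero_of_trinomial_recurrence (f := fun x ↦ f (τ * x))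
      (hf.comp (continuous_const_mul τ))
      (fun A ↦ by
        obtain ⟨C, hC⟩ := hdec A
        refine ⟨C / |τ| ^ A, fun x ↦ ?_⟩
        rw [le_div_iff₀ (by positivity)]
        calc |x| ^ A * ‖f (τ * x)‖ * |τ| ^ A = |τ * x| ^ A * ‖f (τ * x)‖ := by
              rw [abs_mul]
              ring
          _ ≤ C := hC _)
      (d 0 / d' * e (-ξ 0 * s)) (d 1 / d' * e (-ξ 1 * s)) (d 2 / d' * e (-ξ 2 * s))
      (α := (ξ 1 - ξ 0) * τ) (β := (ξ 2 - ξ 0) * τ)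
      (mul_ne_zero (sub_ne_zero.2 (hξ.ne (by decide))) hτ)
      (mul_ne_zero (sub_ne_zero.2 (hξ.ne (by decide))) hτ)
      (fun h ↦ hξ.ne (by decide : (1 : Fin 3) ≠ 2) (by
        have := mul_right_cancel₀ hτ h
        linarith))
      (fun x ↦ by
        have h1 := h (τ * x - s)
        rw [show τ * x - s + t = τ * (x + 1) by rw [hτdef]; ring, sub_add_cancel] at h1
        have h2 : ∑ i, d i * e (ξ i * (τ * x - s)) = d' * e (ξ 0 * (τ * x)) *
            trinomial (d 0 / d' * e (-ξ 0 * s)) (d 1 / d' * e (-ξ 1 * s))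
              (d 2 / d' * e (-ξ 2 * s)) ((ξ 1 - ξ 0) * τ) ((ξ 2 - ξ 0) * τ) x := by
          have h3 : ∀ i, d i * e (ξ i * (τ * x - s)) = d' * e (ξ 0 * (τ * x)) *
              (d i / d' * e (-ξ i * s) * e ((ξ i - ξ 0) * τ * x)) := fun i ↦ by
            rw [show ξ i * (τ * x - s) = ξ 0 * (τ * x) + (-ξ i * s + (ξ i - ξ 0) * τ * x) by ring,
              e_add, e_add]
            field_simp
          simp only [h3, ← Finset.mul_sum, Fin.sum_univ_three, trinomial, sub_self, zero_mul]
          rw [show e 0 = 1 by simp [e], mul_one]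
        rw [h2] at h1
        have h4 := congrArg norm (eq_neg_of_add_eq_zero_left h1)
        simp only [norm_mul, norm_neg, norm_e, mul_one] at h4
        refine mul_left_cancel₀ (norm_ne_zero_iff.2 hd') ?_
        rw [← h4]
        ring)
      (x₀ / τ)
    simpa [mul_div_cancel₀ _ hτ] using key

lemma hasTemperateGrowth_e : Function.HasTemperateGrowth e := by
  have hder : ∀ x, HasDerivAt e (2 * Real.pi * Complex.I * e x) x := fun x ↦ by
    have h := (((Complex.ofRealCLM.hasDerivAt (x := x)).const_mul
      (2 * Real.pi * Complex.I : ℂ))).cexp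
    simp only [Complex.ofRealCLM_apply, Complex.ofReal_one, mul_one] at h
    rw [mul_comm]
    exact h
  have hiter : ∀ n, iteratedDeriv n e = fun x ↦ (2 * Real.pi * Complex.I) ^ n * e x := fun n ↦ by
    induction n with
    | zero => simp
    | succ n ih =>
      rw [iteratedDeriv_succ, ih]
      funext x
      rw [((hder x).const_mul _).deriv]
      ring
  refine ⟨?_, fun n ↦ ⟨0, (2 * Real.pi) ^ n, fun x ↦ ?_⟩⟩
  · have h : ContDiff ℝ (⊤ : ℕ∞) fun x : ℝ ↦ (2 * Real.pi * Complex.I * x : ℂ) :=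
      contDiff_const.mul Complex.ofRealCLM.contDiff
    exact h.cexp
  · rw [norm_iteratedFDeriv_eq_norm_iteratedDeriv, hiter]
    simp [norm_e, abs_of_pos Real.pi_pos]

open FourierTransform in
lemma fourier_eq_integral_e (f : ℝ → ℂ) (y : ℝ) : 𝓕 f y = ∫ x, e (-(x * y)) * f x := by
  rw [Real.fourier_real_eq_integral_exp_smul]
  refine integral_congr_ae (.of_forall fun x ↦ ?_)
  simp only [smul_eq_mul, e]
  congr 2
  push_cast
  ring

open FourierTransform in
lemma integral_e_mul_shift_mul_e (f : ℝ → ℂ) (t η y : ℝ) :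
    ∫ x, e (-(x * y)) * (f (x + t) * e (η * x)) = e (t * (y - η)) * 𝓕 f (y - η) := by
  rw [fourier_eq_integral_e, ← integral_const_mul,
    ← integral_add_right_eq_self (fun x ↦ e (t * (y - η)) * (e (-(x * (y - η))) * f x)) t]
  refine integral_congr_ae (.of_forall fun x ↦ ?_)
  simp only
  rw [mul_comm (f _), ← mul_assoc, ← e_add, ← mul_assoc, ← e_add]
  ring_nf

lemma SchwartzMap.exists_pow_mul_norm_le (f : SchwartzMap ℝ ℂ) (A : ℕ) :
    ∃ C, ∀ x, |x| ^ A * ‖f x‖ ≤ C := by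
  obtain ⟨C, -, hC⟩ := f.decay A 0
  exact ⟨C, fun x ↦ by simpa using hC x⟩

open FourierTransform in
lemma eq_zero_of_three_translations (f : SchwartzMap ℝ ℂ) {t : Fin 3 → ℝ}
    (ht : Function.Injective t) {d : Fin 3 → ℂ} {d' : ℂ} (hd : d' ≠ 0 ∨ ∃ i, d i ≠ 0) {η η' : ℝ}
    (hη : η ≠ η') (t' : ℝ)
    (h : ∀ x, ∑ i, d i * (f (x + t i) * e (η * x)) + d' * (f (x + t') * e (η' * x)) = 0) :
    f = 0 := by
  have hInt : ∀ y s ω : ℝ, Integrable fun x ↦ e (-(x * y)) * (f (x + s) * e (ω * x)) := by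
    intro y s ω
    have h1 : Continuous fun x : ℝ ↦ e (-(x * y)) := continuous_e.comp (by fun_prop)
    have h2 : Continuous fun x : ℝ ↦ e (ω * x) := continuous_e.comp (by fun_prop)
    refine (f.integrable.comp_add_right s).mono
      (h1.mul ((f.continuous.comp (continuous_add_const s)).mul h2)).aestronglyMeasurable
      (.of_forall fun x ↦ ?_)
    simp [norm_e]
  have hfour : ∀ y, ∑ i, d i * (e (t i * (y - η)) * 𝓕 (f : ℝ → ℂ) (y - η)) +
      d' * (e (t' * (y - η')) * 𝓕 (f : ℝ → ℂ) (y - η')) = 0 := fun y ↦ by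
    simp only [← integral_e_mul_shift_mul_e, ← integral_const_mul]
    rw [← integral_finsetSum _ fun i _ ↦ (hInt y (t i) η).const_mul _,
      ← integral_add (integrable_finsetSum _ fun i _ ↦ (hInt y (t i) η).const_mul _)
        ((hInt y t' η').const_mul _)]
    refine integral_eq_zero_of_ae (.of_forall fun x ↦ ?_)
    dsimp only
    have h1 := congrArg (e (-(x * y)) * ·) (h x)
    simp only [mul_zero, mul_add, Finset.mul_sum] at h1
    rw [Pi.zero_apply, ← h1]
    congr 1
    · exact Finset.sum_congr rfl fun i _ ↦ by ring
    · ring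
  have hzero := eq_zero_of_three_modulations (𝓕 f).continuous (𝓕 f).exists_pow_mul_norm_le ht
    (d := fun i ↦ d i * e (-(t i * η))) (d' := d' * e (-(t' * η'))) (s := -η) (t := -η')
    (by
      have he : ∀ x, e x ≠ 0 := fun x ↦ norm_ne_zero_iff.1 (by simp [norm_e])
      simpa [he] using hd)
    (neg_injective.ne hη) t' fun y ↦ by
      have h1 := hfour y
      rw [SchwartzMap.fourier_coe, Finset.sum_mul, ← h1]
      congr 1
      · refine Finset.sum_congr rfl fun i _ ↦ ?_
        rw [show t i * (y - η) = -(t i * η) + t i * y by ring, e_add, ← sub_eq_add_neg]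
        ring
      · rw [show t' * (y - η') = -(t' * η') + t' * y by ring, e_add, ← sub_eq_add_neg]
        ring
  have h0 : 𝓕 f = 0 := by
    ext y
    exact hzero y
  exact (FourierTransform.fourierCLE ℂ (SchwartzMap ℝ ℂ)).map_eq_zero_iff.1 h0

/-- Conjecture 1.2 (HRT for Schwartz functions) holds for (1,3) configurations:
four distinct points such that two distinct parallel lines contain exactly one and
exactly three of them, respectively. -/
theorem hrt_schwartz_one_three_configurations
    (p : Fin 4 → ℝ × ℝ) (hp : Function.Injective p)
    (hconf : ∃ a b c₁ c₂ : ℝ, (a, b) ≠ ((0 : ℝ), (0 : ℝ)) ∧ c₁ ≠ c₂ ∧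
      {i : Fin 4 | a * (p i).1 + b * (p i).2 = c₁}.ncard = 1 ∧
      {i : Fin 4 | a * (p i).1 + b * (p i).2 = c₂}.ncard = 3)
    (f : SchwartzMap ℝ ℂ) (d : Fin 4 → ℂ) (hd : ∃ i, d i ≠ 0)
    (heq : ∀ᵐ x : ℝ, ∑ i, d i * f (x + (p i).1) * e ((p i).2 * x) = 0) :
    ∀ x : ℝ, f x = 0 := by
  obtain ⟨a, b, -, c, hab, -, -, hcard⟩ := hconf
  have heq' : ∀ x, ∑ i, d i * f (x + (p i).1) * e ((p i).2 * x) = 0 := by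
    have h1 : Continuous fun x ↦ ∑ i, d i * f (x + (p i).1) * e ((p i).2 * x) :=
      continuous_finsetSum _ fun i _ ↦
        (continuous_const.mul (f.continuous.comp (continuous_add_const _))).mul
          (continuous_e.comp (continuous_const_mul _))
    exact congrFun ((h1.ae_eq_iff_eq volume continuous_const).1 heq)
  obtain ⟨k, hk⟩ : ∃ k, {i : Fin 4 | a * (p i).1 + b * (p i).2 = c}ᶜ = {k} := by
    rw [← Set.ncard_eq_one, Set.ncard_compl, hcard]
    simp
  have hk' : a * (p k).1 + b * (p k).2 ≠ c := by
    have : k ∈ {i : Fin 4 | a * (p i).1 + b * (p i).2 = c}ᶜ := hk ▸ Set.mem_singleton k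
    exact this
  have hline : ∀ i, a * (p (k.succAbove i)).1 + b * (p (k.succAbove i)).2 = c := fun i ↦ by
    by_contra hcon
    have : k.succAbove i ∈ ({k} : Set (Fin 4)) := hk ▸ hcon
    exact Fin.succAbove_ne k i this
  have hinj : ∀ {i j}, p (k.succAbove i) = p (k.succAbove j) → i = j := fun h ↦
    Fin.succAbove_right_injective (hp h)
  have hd' : d k ≠ 0 ∨ ∃ i, d (k.succAbove i) ≠ 0 := by
    obtain ⟨j, hj⟩ := hd
    rcases Fin.eq_self_or_eq_succAbove k j with rfl | ⟨i, rfl⟩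
    · exact .inl hj
    · exact .inr ⟨i, hj⟩
  by_cases hb : b = 0
  · subst hb
    have ha : a ≠ 0 := fun h ↦ hab (by rw [h])
    simp only [zero_mul, add_zero] at hline hk'
    have hfst : ∀ i, (p (k.succAbove i)).1 = c / a := fun i ↦ by
      rw [eq_div_iff ha, mul_comm]
      exact hline i
    refine eq_zero_of_three_modulations f.continuous f.exists_pow_mul_norm_le
      (ξ := fun i ↦ (p (k.succAbove i)).2)
      (fun i j h ↦ hinj (Prod.ext ((hfst i).trans (hfst j).symm) h)) hd' (s := c / a)
      (t := (p k).1) (fun h ↦ hk' (by rw [← h, mul_div_cancel₀ _ ha])) (p k).2 fun x ↦ ?_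
    rw [← heq' x, Fin.sum_univ_succAbove _ k, add_comm, Finset.sum_mul]
    congr 1
    · ring
    · refine Finset.sum_congr rfl fun i _ ↦ ?_
      rw [hfst]
      ring
  · set κ := -(a / b) with hκ
    have hsnd : ∀ i, (p (k.succAbove i)).2 - κ * (p (k.succAbove i)).1 = c / b := fun i ↦ by
      rw [← hline i, hκ]
      field_simp
      ring
    have hchirp : Function.HasTemperateGrowth fun x : ℝ ↦ e (κ / 2 * x ^ 2) :=
      hasTemperateGrowth_e.comp
        (by fun_prop : Function.HasTemperateGrowth fun x : ℝ ↦ κ / 2 * x ^ 2)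
    set F := SchwartzMap.smulLeftCLM ℂ (fun x : ℝ ↦ e (κ / 2 * x ^ 2)) f with hF
    have hFapp : ∀ x, F x = e (κ / 2 * x ^ 2) * f x := fun x ↦ by
      rw [hF, SchwartzMap.smulLeftCLM_apply_apply hchirp, smul_eq_mul]
    have he : ∀ x, e x ≠ 0 := fun x ↦ norm_ne_zero_iff.1 (by simp [norm_e])
    have hterm : ∀ i x, d i * e (-(κ / 2 * (p i).1 ^ 2)) *
        (F (x + (p i).1) * e (((p i).2 - κ * (p i).1) * x)) =
          e (κ / 2 * x ^ 2) * (d i * f (x + (p i).1) * e ((p i).2 * x)) := fun i x ↦ by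
      have h1 : e (κ / 2 * x ^ 2) * e ((p i).2 * x) = e (-(κ / 2 * (p i).1 ^ 2)) *
          (e (κ / 2 * (x + (p i).1) ^ 2) * e (((p i).2 - κ * (p i).1) * x)) := by
        simp only [← e_add]
        ring_nf
      rw [hFapp]
      linear_combination (-(d i * f (x + (p i).1))) * h1
    have hF0 := eq_zero_of_three_translations F (t := fun i ↦ (p (k.succAbove i)).1)
      (d := fun i ↦ d (k.succAbove i) * e (-(κ / 2 * (p (k.succAbove i)).1 ^ 2)))
      (d' := d k * e (-(κ / 2 * (p k).1 ^ 2))) (η := c / b) (η' := (p k).2 - κ * (p k).1)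
      (fun i j (h : (p (k.succAbove i)).1 = (p (k.succAbove j)).1) ↦ hinj (Prod.ext h (by
        have := (hsnd i).trans (hsnd j).symm
        rw [h] at this
        linarith)))
      (by simpa [he] using hd')
      (fun h ↦ hk' (by
        rw [div_eq_iff hb] at h
        rw [h, hκ]
        field_simp
        ring))
      (p k).1 fun x ↦ by
        have h1 := congrArg (e (κ / 2 * x ^ 2) * ·) (heq' x)
        simp only [mul_zero, Finset.mul_sum, ← hterm] at h1
        rw [Fin.sum_univ_succAbove _ k, add_comm] at h1
        simpa only [hsnd] using h1
    intro x
    have h1 := hFapp x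
    rw [hF0, zero_apply, eq_comm, mul_eq_zero] at h1
    exact h1.resolve_left (he _)
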